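/- P ∩ ι(H) = T·T̃·Ñ: an element ι(h) with h ∈ H lies in the Siegel parabolic P if and only if h is upper triangular, and the set of such elements equals {x_λ·t̃_a·ñ : λ ∈ kˣ, a ∈ Kˣ, ñ ∈ Ñ}, the Borel subgroup B_H of ι(H) (second part of Lemma 2.4). -/

import Mathlib

open Matrix

/-- The standard symplectic matrix `J = ((0,E₂),(−E₂,0))` of `GSp(4)`. -/
def J4 (k : Type*) [Field k] : Matrix (Fin 4) (Fin 4) k :=
  !![0, 0, 1, 0; 0, 0, 0, 1; -1, 0, 0, 0; 0, -1, 0, 0]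

/-- Membership in `G = GSp(4,k)`. -/
def IsGSp {k : Type*} [Field k] (g : Matrix (Fin 4) (Fin 4) k) : Prop :=
  IsUnit g.det ∧ ∃ lam : k, lam ≠ 0 ∧ gᵀ * J4 k * g = lam • J4 k

/-- `L₀ = span_k(e₁,e₂) ⊆ k⁴`. -/
def L0 (k : Type*) [Field k] : Submodule k (Fin 4 → k) :=
  Submodule.span k {![1, 0, 0, 0], ![0, 1, 0, 0]}

/-- The Siegel parabolic `P = {g ∈ G : g·L₀ = L₀}`. -/
def Pset (k : Type*) [Field k] : Set (Matrix (Fin 4) (Fin 4) k) :=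
  {g | IsGSp g ∧ Submodule.map g.mulVecLin (L0 k) = L0 k}

/-- The embedding `ι : H → GL(4,k)`. -/
def iota {k K : Type*} [Field k] [Field K] (α : k) (c1 c2 : K → k)
    (m : Matrix (Fin 2) (Fin 2) K) : Matrix (Fin 4) (Fin 4) k :=
  !![c1 (m 0 0), c2 (m 0 0) * α, c1 (m 0 1), c2 (m 0 1);
     c2 (m 0 0), c1 (m 0 0), c2 (m 0 1), c1 (m 0 1) / α;
     c1 (m 1 0), c2 (m 1 0) * α, c1 (m 1 1), c2 (m 1 1);
     c2 (m 1 0) * α, c1 (m 1 0) * α, c2 (m 1 1) * α, c1 (m 1 1)]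

/-- Membership in `H = {g ∈ GL(2,K) : det g ∈ kˣ}`. -/
def InH {k K : Type*} [Field k] [Field K] [Algebra k K]
    (m : Matrix (Fin 2) (Fin 2) K) : Prop :=
  ∃ d : k, d ≠ 0 ∧ m.det = algebraMap k K d

/-- The torus `T = {x_λ = diag(λ,λ,1,1) : λ ∈ kˣ}`. -/
def Tset (k : Type*) [Field k] : Set (Matrix (Fin 4) (Fin 4) k) :=
  {t | ∃ lam : k, lam ≠ 0 ∧
    t = !![lam, 0, 0, 0; 0, lam, 0, 0; 0, 0, 1, 0; 0, 0, 0, 1]}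

/-- The matrix `t̃_a = diag(a, ā)` for `a = a₁ + a₂√α ∈ Kˣ`, in coordinates. -/
def ttilde {k : Type*} [Field k] (α a1 a2 : k) : Matrix (Fin 4) (Fin 4) k :=
  !![a1, a2 * α, 0, 0; a2, a1, 0, 0; 0, 0, a1, -a2; 0, 0, -a2 * α, a1]

/-- The torus `T̃ = {t̃_a : a ∈ Kˣ}`. -/
def Ttilde {k K : Type*} [Field k] [Field K] (α : k) (c1 c2 : K → k) :
    Set (Matrix (Fin 4) (Fin 4) k) :=
  {t | ∃ a : K, a ≠ 0 ∧ t = ttilde α (c1 a) (c2 a)}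

/-- The subgroup `Ñ ⊆ N` with upper-right block `((b₁,b₂),(b₂,b₁/α))`. -/
def Ntset (k : Type*) [Field k] (α : k) : Set (Matrix (Fin 4) (Fin 4) k) :=
  {n | ∃ b1 b2 : k, n = !![1, 0, b1, b2; 0, 1, b2, b1 / α; 0, 0, 1, 0; 0, 0, 0, 1]}

section Coordinates

variable {k : Type*} [Field k]

lemma mem_L0_iff {v : Fin 4 → k} : v ∈ L0 k ↔ v 2 = 0 ∧ v 3 = 0 := by
  rw [L0, Submodule.mem_span_pair]
  constructor
  · rintro ⟨a, b, rfl⟩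
    simp
  · rintro ⟨h2, h3⟩
    refine ⟨v 0, v 1, ?_⟩
    ext i
    fin_cases i <;> simp [h2, h3]

/-- The block upper triangular matrix attached to `((a, b), (0, d))`, in coordinates. -/
def blockUpper (α a1 a2 b1 b2 d1 d2 : k) : Matrix (Fin 4) (Fin 4) k :=
  !![a1, a2 * α, b1, b2; a2, a1, b2, b1 / α; 0, 0, d1, d2; 0, 0, d2 * α, d1]

lemma det_blockUpper (α a1 a2 b1 b2 d1 d2 : k) :
    (blockUpper α a1 a2 b1 b2 d1 d2).det =
      (a1 * d1 + α * a2 * d2) ^ 2 - α * (a1 * d2 + a2 * d1) ^ 2 := by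
  simp [blockUpper, Matrix.det_succ_row_zero, Fin.sum_univ_succ, Fin.succAbove]
  ring

lemma blockUpper_mem_Pset {α a1 a2 b1 b2 d1 d2 δ : k} (hα : α ≠ 0) (hδ : δ ≠ 0)
    (h1 : a1 * d1 + α * a2 * d2 = δ) (h2 : a1 * d2 + a2 * d1 = 0) :
    blockUpper α a1 a2 b1 b2 d1 d2 ∈ Pset k := by
  refine ⟨⟨?_, δ, hδ, ?_⟩, ?_⟩
  · rw [det_blockUpper, h1, h2]
    simpa using hδ
  · ext i j
    fin_cases i <;> fin_cases j <;>
      simp [blockUpper, J4, Matrix.mul_apply, Fin.sum_univ_succ] <;> field_simp <;> grind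
  · ext v
    simp only [Submodule.mem_map, mem_L0_iff, Matrix.mulVecLin_apply]
    constructor
    · rintro ⟨w, ⟨h2, h3⟩, rfl⟩
      simp [blockUpper, Matrix.mulVec, dotProduct, Fin.sum_univ_succ] at h2 h3 ⊢
      simp [h2, h3]
    · rintro ⟨hv2, hv3⟩
      refine ⟨![(d1 * v 0 + α * d2 * v 1) / δ, (d2 * v 0 + d1 * v 1) / δ, 0, 0],
        by simp, ?_⟩
      ext i
      fin_cases i <;>
        simp [blockUpper, Matrix.mulVec, dotProduct, Fin.sum_univ_succ, hv2, hv3] <;>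
        field_simp <;> grind

lemma diag_mul_ttilde_mul_unipotent (α lam a1 a2 b1 b2 : k) (hα : α ≠ 0) :
    !![lam, 0, 0, 0; 0, lam, 0, 0; 0, 0, 1, 0; 0, 0, 0, 1] * ttilde α a1 a2 *
        !![1, 0, b1, b2; 0, 1, b2, b1 / α; 0, 0, 1, 0; 0, 0, 0, 1] =
      blockUpper α (lam * a1) (lam * a2) (lam * (a1 * b1 + α * a2 * b2))
        (lam * (a1 * b2 + a2 * b1)) a1 (-a2) := by
  ext i j
  fin_cases i <;> fin_cases j <;>
    simp [blockUpper, ttilde, Matrix.mul_apply, Fin.sum_univ_succ] <;> field_simp <;> try ring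

lemma sq_sub_mul_sq_ne_zero {α a1 a2 : k} (hns : ¬ IsSquare α) (h : a1 ≠ 0 ∨ a2 ≠ 0) :
    a1 ^ 2 - α * a2 ^ 2 ≠ 0 := by
  intro h0
  by_cases h2 : a2 = 0
  · simp_all
  · exact hns ⟨a1 / a2, by field_simp; linear_combination -h0⟩

end Coordinates

section QuadraticExtension

variable {k K : Type*} [Field k] [Field K] [Algebra k K] {α : k} {r : K} {c1 c2 : K → k}

lemma coords_eq
    (hrepr : ∀ x : K, x = algebraMap k K (c1 x) + algebraMap k K (c2 x) * r)
    (hindep : ∀ y1 y2 : k, algebraMap k K y1 + algebraMap k K y2 * r = 0 → y1 = 0 ∧ y2 = 0)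
    {x : K} {y1 y2 : k} (h : x = algebraMap k K y1 + algebraMap k K y2 * r) :
    c1 x = y1 ∧ c2 x = y2 := by
  have := hindep (c1 x - y1) (c2 x - y2) (by
    rw [map_sub, map_sub]
    linear_combination h - hrepr x)
  exact ⟨sub_eq_zero.mp this.1, sub_eq_zero.mp this.2⟩

lemma iota_eq_blockUpper
    (hrepr : ∀ x : K, x = algebraMap k K (c1 x) + algebraMap k K (c2 x) * r)
    (hindep : ∀ y1 y2 : k, algebraMap k K y1 + algebraMap k K y2 * r = 0 → y1 = 0 ∧ y2 = 0)
    {h : Matrix (Fin 2) (Fin 2) K} (h10 : h 1 0 = 0) :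
    iota α c1 c2 h = blockUpper α (c1 (h 0 0)) (c2 (h 0 0)) (c1 (h 0 1)) (c2 (h 0 1))
      (c1 (h 1 1)) (c2 (h 1 1)) := by
  obtain ⟨z1, z2⟩ := coords_eq hrepr hindep (x := 0) (y1 := 0) (y2 := 0) (by simp)
  simp [iota, blockUpper, h10, z1, z2]

lemma coords_of_mul_eq (hr : r * r = algebraMap k K α)
    (hrepr : ∀ x : K, x = algebraMap k K (c1 x) + algebraMap k K (c2 x) * r)
    (hindep : ∀ y1 y2 : k, algebraMap k K y1 + algebraMap k K y2 * r = 0 → y1 = 0 ∧ y2 = 0)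
    {x y : K} {δ : k} (h : x * y = algebraMap k K δ) :
    c1 x * c1 y + α * c2 x * c2 y = δ ∧ c1 x * c2 y + c2 x * c1 y = 0 := by
  have key := hindep (c1 x * c1 y + α * c2 x * c2 y - δ) (c1 x * c2 y + c2 x * c1 y) (by
    rw [hrepr x, hrepr y] at h
    simp only [map_sub, map_add, map_mul]
    linear_combination h - algebraMap k K (c2 x) * algebraMap k K (c2 y) * hr)
  exact ⟨sub_eq_zero.mp key.1, key.2⟩

lemma iota_mem_Pset_iff (hα : α ≠ 0) (hr : r * r = algebraMap k K α)
    (hrepr : ∀ x : K, x = algebraMap k K (c1 x) + algebraMap k K (c2 x) * r)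
    (hindep : ∀ y1 y2 : k, algebraMap k K y1 + algebraMap k K y2 * r = 0 → y1 = 0 ∧ y2 = 0)
    {h : Matrix (Fin 2) (Fin 2) K} (hh : InH (k := k) h) :
    iota α c1 c2 h ∈ Pset k ↔ h 1 0 = 0 := by
  constructor
  · rintro ⟨-, hmap⟩
    have hmem : (iota α c1 c2 h).mulVecLin ![1, 0, 0, 0] ∈ L0 k :=
      hmap ▸ Submodule.mem_map_of_mem (mem_L0_iff.mpr (by simp))
    rw [mem_L0_iff] at hmem
    simp [iota, Matrix.mulVec, dotProduct, Fin.sum_univ_succ, hα] at hmem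
    rw [hrepr (h 1 0), hmem.1, hmem.2]
    simp
  · intro h10
    obtain ⟨δ, hδ, hdet⟩ := hh
    rw [Matrix.det_fin_two, h10, mul_zero, sub_zero] at hdet
    obtain ⟨h1, h2⟩ := coords_of_mul_eq hr hrepr hindep hdet
    rw [iota_eq_blockUpper hrepr hindep h10]
    exact blockUpper_mem_Pset hα hδ h1 h2

end QuadraticExtension

/-- `P ∩ ι(H) = T·T̃·Ñ = B_H`: for `h ∈ H`, `ι(h) ∈ P` iff `h` is upper
triangular, and the set of such `ι(h)` equals
`{x_λ·t̃_a·ñ : λ ∈ kˣ, a ∈ Kˣ, ñ ∈ Ñ}`. -/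
theorem statement11
    {k K : Type*} [Field k] [Field K] [Algebra k K]
    (hchar : (2 : k) ≠ 0)
    (α : k) (hα : α ≠ 0) (hns : ¬ IsSquare α)
    (r : K) (hr : r * r = algebraMap k K α)
    (c1 c2 : K → k)
    (hrepr : ∀ x : K, x = algebraMap k K (c1 x) + algebraMap k K (c2 x) * r)
    (hindep : ∀ y1 y2 : k, algebraMap k K y1 + algebraMap k K y2 * r = 0 →
      y1 = 0 ∧ y2 = 0) :
    (∀ h : Matrix (Fin 2) (Fin 2) K, InH (k := k) h →
      (iota α c1 c2 h ∈ Pset k ↔ h 1 0 = 0))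
    ∧ {g : Matrix (Fin 4) (Fin 4) k |
          ∃ h : Matrix (Fin 2) (Fin 2) K,
            InH (k := k) h ∧ g = iota α c1 c2 h ∧ g ∈ Pset k}
      = {g : Matrix (Fin 4) (Fin 4) k |
          ∃ x ∈ Tset k, ∃ t ∈ Ttilde (K := K) α c1 c2, ∃ n ∈ Ntset k α,
            g = x * t * n} := by
  have hiff := fun h (hh : InH (k := k) h) => iota_mem_Pset_iff hα hr hrepr hindep hh
  refine ⟨hiff, ?_⟩
  ext g
  constructor
  · rintro ⟨h, hh, rfl, hP⟩
    have h10 := (hiff h hh).mp hP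
    obtain ⟨δ, hδ, hdet⟩ := hh
    rw [Matrix.det_fin_two, h10, mul_zero, sub_zero] at hdet
    obtain ⟨h1, h2⟩ := coords_of_mul_eq hr hrepr hindep hdet
    rw [iota_eq_blockUpper hrepr hindep h10]
    generalize c1 (h 0 0) = a1, c2 (h 0 0) = a2, c1 (h 0 1) = b1, c2 (h 0 1) = b2,
      c1 (h 1 1) = d1, c2 (h 1 1) = d2 at h1 h2 ⊢
    have hd : d1 ≠ 0 ∨ d2 ≠ 0 := by
      by_contra! hd
      exact hδ (by rw [← h1, hd.1, hd.2]; ring)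
    have hN : d1 ^ 2 - α * d2 ^ 2 ≠ 0 := sq_sub_mul_sq_ne_zero hns hd
    obtain ⟨e1, e2⟩ := coords_eq hrepr hindep
      (x := algebraMap k K d1 + algebraMap k K (-d2) * r) rfl
    refine ⟨_, ⟨δ / (d1 ^ 2 - α * d2 ^ 2), div_ne_zero hδ hN, rfl⟩, _,
      ⟨algebraMap k K d1 + algebraMap k K (-d2) * r, ?_, rfl⟩, _,
      ⟨(d1 * b1 + α * d2 * b2) / δ, (d1 * b2 + d2 * b1) / δ, rfl⟩, ?_⟩
    · intro h0
      obtain ⟨z1, z2⟩ := hindep _ _ h0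
      exact hd.elim (· z1) (· (neg_eq_zero.mp z2))
    · rw [e1, e2, diag_mul_ttilde_mul_unipotent _ _ _ _ _ _ hα]
      congr 1
      · field_simp
        linear_combination d1 * h1 - α * d2 * h2
      · field_simp
        linear_combination d1 * h2 - d2 * h1
      · field_simp
        ring
      · field_simp
        ring
      · ring
  · rintro ⟨_, ⟨lam, hlam, rfl⟩, _, ⟨a, ha, rfl⟩, _, ⟨b1, b2, rfl⟩, rfl⟩
    rw [diag_mul_ttilde_mul_unipotent _ _ _ _ _ _ hα]
    have hra := hrepr a
    generalize c1 a = a1, c2 a = a2 at hra ⊢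
    have hN : a1 ^ 2 - α * a2 ^ 2 ≠ 0 := sq_sub_mul_sq_ne_zero hns (by
      by_contra! h0
      exact ha (by rw [hra, h0.1, h0.2]; simp))
    let f : k → k → K := fun y1 y2 => algebraMap k K y1 + algebraMap k K y2 * r
    have hf (y1 y2 : k) : c1 (f y1 y2) = y1 ∧ c2 (f y1 y2) = y2 :=
      coords_eq hrepr hindep rfl
    let h : Matrix (Fin 2) (Fin 2) K :=
      !![f (lam * a1) (lam * a2), f (lam * (a1 * b1 + α * a2 * b2)) (lam * (a1 * b2 + a2 * b1));
        0, f a1 (-a2)]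
    have hh : InH (k := k) h := by
      refine ⟨lam * (a1 ^ 2 - α * a2 ^ 2), mul_ne_zero hlam hN, ?_⟩
      simp only [h, f, Matrix.det_fin_two_of, map_mul, map_sub, map_pow, map_neg]
      linear_combination (-algebraMap k K lam * algebraMap k K a2 ^ 2) * hr
    have heq : blockUpper α (lam * a1) (lam * a2) (lam * (a1 * b1 + α * a2 * b2))
        (lam * (a1 * b2 + a2 * b1)) a1 (-a2) = iota α c1 c2 h := by
      rw [iota_eq_blockUpper hrepr hindep (by simp [h])]
      simp [h, hf]
    exact ⟨h, hh, heq, heq ▸ (hiff h hh).mpr (by simp [h])⟩
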